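/- arXiv:1610.08614 — 7 statements merged into one kernel-verified Lean document; each statement's English description precedes it below -/
import Mathlib

section
/- Let n ≥ 1 and let M = fromBlocks A B C D be a real (2n)×(2n) symplectic matrix (M * J * Mᵀ = J with J = fromBlocks 0 1 (-1) 0) whose block A is invertible. Define V : ℝⁿ × ℝⁿ → ℝ by V(x₁, y₀) = -(1/2)·⟨x₁, C A⁻¹ x₁⟩ + ⟨y₀, (I − A⁻¹) x₁⟩ + (1/2)·⟨y₀, A⁻¹ B y₀⟩, where ⟨·,·⟩ is the dot product. Then for all x₀, y₀ ∈ ℝⁿ, setting x₁ = A x₀ + B y₀ and y₁ = C x₀ + D y₀, the gradient of the function y ↦ V(x₁, y) at y₀ equals x₁ − x₀, and the gradient of the function x ↦ V(x, y₀) at x₁ equals −(y₁ − y₀). In other words, V is a generating function of type V for the linear symplectomorphism M. -/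
open Matrix

/-- The gradient of `y ↦ c + ⟨b, y⟩ + (1/2)⟨y, S y⟩`, for symmetric `S`, is `S y + b`. -/
theorem hasGradientAt_quadratic {ι : Type*} [Fintype ι] [DecidableEq ι] {S : Matrix ι ι ℝ}
    (hS : Sᵀ = S) (b : ι → ℝ) (c : ℝ) (y : EuclideanSpace ℝ ι) :
    HasGradientAt (fun y : EuclideanSpace ℝ ι ↦ c + b ⬝ᵥ y + 1 / 2 * (y ⬝ᵥ S *ᵥ y))
      (WithLp.toLp 2 (S *ᵥ y + b)) y := by
  rw [hasGradientAt_iff_hasFDerivAt]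
  have hquad := (hasFDerivAt_id y).inner ℝ (toEuclideanCLM (n := ι) (𝕜 := ℝ) S).hasFDerivAt
  have hlin := (innerSL ℝ (WithLp.toLp 2 b : EuclideanSpace ℝ ι)).hasFDerivAt (x := y)
  have hsum := (hlin.const_add c).add (hquad.const_mul (1 / 2))
  refine (hsum.congr_fderiv ?_).congr_of_eventuallyEq (.of_forall fun z ↦ ?_)
  · ext v
    have hsymm : v.ofLp ⬝ᵥ S *ᵥ y.ofLp = S *ᵥ v.ofLp ⬝ᵥ y.ofLp := by
      rw [dotProduct_mulVec, ← mulVec_transpose, hS]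
    simp [EuclideanSpace.inner_eq_star_dotProduct, ofLp_toEuclideanCLM,
      dotProduct_comm (S *ᵥ y.ofLp) v.ofLp, hsymm]
    ring
  · simp [EuclideanSpace.inner_eq_star_dotProduct, ofLp_toEuclideanCLM, dotProduct_comm]



/-- for a symplectic matrix `fromBlocks A B C D` with `A` invertible, the
function `V(x₁,y₀) = -(1/2)⟨x₁, CA⁻¹x₁⟩ + ⟨y₀, (I - A⁻¹)x₁⟩ + (1/2)⟨y₀, A⁻¹B y₀⟩`
is a generating function of type V. -/
theorem generating_function_of_type_V (n : ℕ) (hn : 1 ≤ n)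
    (A B C D : Matrix (Fin n) (Fin n) ℝ)
    (hsymp : fromBlocks A B C D * Matrix.J (Fin n) ℝ * (fromBlocks A B C D)ᵀ
        = Matrix.J (Fin n) ℝ)
    (hA : IsUnit A)
    (V : EuclideanSpace ℝ (Fin n) → EuclideanSpace ℝ (Fin n) → ℝ)
    (hV : ∀ x y : EuclideanSpace ℝ (Fin n),
      V x y = -(1 / 2) * (x ⬝ᵥ (C * A⁻¹).mulVec x) + (y ⬝ᵥ ((1 - A⁻¹).mulVec x))
        + (1 / 2) * (y ⬝ᵥ (A⁻¹ * B).mulVec y)) :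
    ∀ x₀ y₀ : EuclideanSpace ℝ (Fin n),
      ∀ x₁ y₁ : EuclideanSpace ℝ (Fin n),
        x₁ = A.mulVec x₀ + B.mulVec y₀ →
        y₁ = C.mulVec x₀ + D.mulVec y₀ →
        gradient (fun y => V x₁ y) y₀ = x₁ - x₀ ∧
        gradient (fun x => V x y₀) x₁ = -(y₁ - y₀) := by
  intro x₀ y₀ x₁ y₁ hx₁ hy₁
  have hdet : IsUnit A.det := (isUnit_iff_isUnit_det A).1 hA
  have hmem : fromBlocks A B C D ∈ symplecticGroup (Fin n) ℝ :=
    SymplecticGroup.mem_iff.2 hsymp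
  obtain ⟨hAC, -, hAD⟩ := SymplecticGroup.fromBlocks_mem_iff.1 hmem
  have hAB : A * Bᵀ = B * Aᵀ := by
    have h := SymplecticGroup.transpose_mem hmem
    rw [fromBlocks_transpose, SymplecticGroup.fromBlocks_mem_iff] at h
    simpa using h.1
  have hATdet : IsUnit Aᵀ.det := by rwa [det_transpose]
  have hS₁ : (A⁻¹ * B)ᵀ = A⁻¹ * B := by
    rw [transpose_mul, transpose_nonsing_inv]
    calc Bᵀ * Aᵀ⁻¹ = A⁻¹ * (A * Bᵀ) * Aᵀ⁻¹ := by rw [nonsing_inv_mul_cancel_left _ _ hdet]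
      _ = A⁻¹ * B := by
        rw [hAB, ← Matrix.mul_assoc, mul_nonsing_inv_cancel_right _ _ hATdet]
  have hS₂ : (C * A⁻¹)ᵀ = C * A⁻¹ := by
    rw [transpose_mul, transpose_nonsing_inv]
    calc Aᵀ⁻¹ * Cᵀ = Aᵀ⁻¹ * (Cᵀ * A) * A⁻¹ := by
          rw [← Matrix.mul_assoc, mul_nonsing_inv_cancel_right _ _ hdet]
      _ = C * A⁻¹ := by rw [← hAC, nonsing_inv_mul_cancel_left _ _ hATdet]
  have hD : D = C * A⁻¹ * B + (A⁻¹)ᵀ := by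
    have hC : Cᵀ = Aᵀ * (C * A⁻¹) := by
      rw [← Matrix.mul_assoc, hAC, mul_nonsing_inv_cancel_right _ _ hdet]
    have h : Aᵀ * (D - C * A⁻¹ * B) = 1 := by
      rw [Matrix.mul_sub, ← hAD, hC, Matrix.mul_assoc Aᵀ]
    rw [transpose_nonsing_inv, inv_eq_right_inv h]
    abel
  have hx₀ : A⁻¹ *ᵥ x₁ = x₀ + (A⁻¹ * B) *ᵥ y₀ := by
    rw [hx₁, mulVec_add, mulVec_mulVec, mulVec_mulVec, nonsing_inv_mul _ hdet, one_mulVec]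
  constructor
  · have h := hasGradientAt_quadratic hS₁ ((1 - A⁻¹) *ᵥ x₁)
      (-(1 / 2) * (x₁ ⬝ᵥ (C * A⁻¹) *ᵥ x₁)) y₀
    have hVy : (fun y ↦ V x₁ y) = fun y : EuclideanSpace ℝ (Fin n) ↦
        -(1 / 2) * (x₁ ⬝ᵥ (C * A⁻¹) *ᵥ x₁) + (1 - A⁻¹) *ᵥ x₁ ⬝ᵥ y
          + 1 / 2 * (y ⬝ᵥ (A⁻¹ * B) *ᵥ y) := by
      funext y
      rw [hV, dotProduct_comm y.ofLp ((1 - A⁻¹) *ᵥ x₁.ofLp)]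
    rw [hVy, h.gradient]
    apply WithLp.ofLp_injective 2
    rw [WithLp.ofLp_toLp, WithLp.ofLp_sub, sub_mulVec, one_mulVec, hx₀]
    abel
  · have hS : (-(C * A⁻¹))ᵀ = -(C * A⁻¹) := by rw [transpose_neg, hS₂]
    have h := hasGradientAt_quadratic hS ((1 - A⁻¹)ᵀ *ᵥ y₀)
      (1 / 2 * (y₀ ⬝ᵥ (A⁻¹ * B) *ᵥ y₀)) x₁
    have hVx : (fun x ↦ V x y₀) = fun x : EuclideanSpace ℝ (Fin n) ↦
        1 / 2 * (y₀ ⬝ᵥ (A⁻¹ * B) *ᵥ y₀) + (1 - A⁻¹)ᵀ *ᵥ y₀ ⬝ᵥ x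
          + 1 / 2 * (x ⬝ᵥ (-(C * A⁻¹)) *ᵥ x) := by
      funext x
      rw [hV, dotProduct_mulVec y₀.ofLp (1 - A⁻¹), mulVec_transpose, neg_mulVec, dotProduct_neg]
      ring
    rw [hVx, h.gradient]
    apply WithLp.ofLp_injective 2
    rw [WithLp.ofLp_toLp, WithLp.ofLp_neg, WithLp.ofLp_sub, hy₁, hD, neg_mulVec,
      ← mulVec_mulVec x₁.ofLp, hx₀, transpose_sub, transpose_one, sub_mulVec, one_mulVec,
      mulVec_add, mulVec_mulVec, add_mulVec, Matrix.mul_assoc]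
    abel
end

section
/- Let n ≥ 1 and let M = fromBlocks A B C D be a real (2n)×(2n) symplectic matrix (M * J * Mᵀ = J with J = fromBlocks 0 1 (-1) 0). Suppose there exists a differentiable function V : ℝⁿ × ℝⁿ → ℝ such that for all x₀, y₀ ∈ ℝⁿ, setting x₁ = A x₀ + B y₀ and y₁ = C x₀ + D y₀, the gradient of y ↦ V(x₁, y) at y₀ equals x₁ − x₀ and the gradient of x ↦ V(x, y₀) at x₁ equals −(y₁ − y₀). Then the block A is invertible. (Hence a linear symplectomorphism admits a generating function of type V if and only if det A ≠ 0.) -/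
open Matrix

/-- if a symplectic matrix `fromBlocks A B C D` admits a differentiable
generating function of type V, then the block `A` is invertible. -/
theorem generating_function_implies_A_invertible (n : ℕ) (hn : 1 ≤ n)
    (A B C D : Matrix (Fin n) (Fin n) ℝ)
    (hsymp : fromBlocks A B C D * Matrix.J (Fin n) ℝ * (fromBlocks A B C D)ᵀ
        = Matrix.J (Fin n) ℝ)
    (V : EuclideanSpace ℝ (Fin n) → EuclideanSpace ℝ (Fin n) → ℝ)
    (hV : Differentiable ℝ (fun p : EuclideanSpace ℝ (Fin n) × EuclideanSpace ℝ (Fin n) =>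
      V p.1 p.2))
    (hgen : ∀ x₀ y₀ x₁ y₁ : EuclideanSpace ℝ (Fin n),
      x₁ = A.mulVec x₀ + B.mulVec y₀ →
      y₁ = C.mulVec x₀ + D.mulVec y₀ →
      gradient (fun y => V x₁ y) y₀ = x₁ - x₀ ∧
      gradient (fun x => V x y₀) x₁ = -(y₁ - y₀)) :
    IsUnit A := by
  rw [← mulVec_injective_iff_isUnit]
  refine (injective_iff_map_eq_zero A.mulVecLin).mpr fun v hv => ?_
  replace hv : A.mulVec v = 0 := hv
  have h₁ := (hgen (WithLp.toLp 2 v) 0 0 (WithLp.toLp 2 (C.mulVec v))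
    (by simp [hv]) (by simp)).1
  have h₂ := (hgen 0 0 0 0 (by simp) (by simp)).1
  have h : (0 : EuclideanSpace ℝ (Fin n)) - WithLp.toLp 2 v = 0 - 0 := h₁.symm.trans h₂
  simpa using h
end

section
/- Let c > 0 and a > 0 be real numbers. For each positive integer N, let μ_N be the Gaussian measure on ℝ with mean 0 and variance c/N. Then the sequence N ↦ (μ_N {x : |x| < a})^N converges to 1 as N → ∞. (In particular, N independent Gaussian increments of variance c/N almost surely all lie in any fixed neighborhood of 0 as N → ∞.) -/
open MeasureTheory ProbabilityTheory Filter

/-- A centred Gaussian has a sub-Gaussian moment generating function with its variance as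
parameter. -/
lemma hasSubgaussianMGF_id_gaussianReal (v : NNReal) :
    HasSubgaussianMGF id v (gaussianReal 0 v) where
  integrable_exp_mul t := integrable_exp_mul_gaussianReal t
  mgf_le t := by simp [mgf_id_gaussianReal]

/-- Two-sided tail bound for a centred Gaussian, stated for the complementary event. -/
lemma one_sub_le_gaussianReal_abs_lt (v : NNReal) {a : ℝ} (ha : 0 ≤ a) :
    1 - 2 * Real.exp (-a ^ 2 / (2 * v)) ≤ (gaussianReal 0 v).real {x : ℝ | |x| < a} := by
  have h := hasSubgaussianMGF_id_gaussianReal v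
  have hpos := h.measure_ge_le ha
  have hneg := h.neg.measure_ge_le ha
  have hmeas : MeasurableSet {x : ℝ | |x| < a} := measurableSet_lt (by fun_prop) (by fun_prop)
  have hsub : {x : ℝ | |x| < a}ᶜ ⊆ {x : ℝ | a ≤ id x} ∪ {x : ℝ | a ≤ (-id) x} := by
    intro x hx
    simpa [le_abs] using hx
  have hunion := (measureReal_mono (μ := gaussianReal 0 v) hsub).trans (measureReal_union_le _ _)
  rw [probReal_compl_eq_one_sub hmeas] at hunion
  linarith

/-- For `c, a > 0`, if `μ_N` is the Gaussian measure on `ℝ` with mean 0 and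
variance `c / N`, then `(μ_N {x : |x| < a})^N → 1` as `N → ∞`. -/
theorem gaussian_small_increments (c a : ℝ) (hc : 0 < c) (ha : 0 < a) :
    Tendsto
      (fun N : ℕ =>
        ((gaussianReal 0 (Real.toNNReal (c / N)) {x : ℝ | |x| < a}).toReal) ^ N)
      atTop (nhds 1) := by
  set r : ℝ := Real.exp (-a ^ 2 / (2 * c)) with hr
  have hr1 : r < 1 := by
    rw [hr, Real.exp_lt_one_iff, neg_div, neg_lt_zero]
    positivity
  have hlim : Tendsto (fun N : ℕ => 1 + (N : ℝ) * (-(2 * r ^ N))) atTop (nhds 1) := by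
    have h := (tendsto_self_mul_const_pow_of_lt_one (Real.exp_pos _).le hr1).const_mul (-2)
    convert h.const_add 1 using 2
    · ring
    · norm_num
  refine tendsto_of_tendsto_of_tendsto_of_le_of_le hlim tendsto_const_nhds (fun N => ?_)
    (fun N => pow_le_one₀ ENNReal.toReal_nonneg measureReal_le_one)
  rcases N.eq_zero_or_pos with rfl | hN
  · simp
  have hN' : (0 : ℝ) < N := by exact_mod_cast hN
  have hexp : r ^ N = Real.exp (-a ^ 2 / (2 * (Real.toNNReal (c / N) : ℝ))) := by
    rw [hr, ← Real.exp_nat_mul, Real.coe_toNNReal _ (by positivity)]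
    congr 1
    field_simp
  have htail := one_sub_le_gaussianReal_abs_lt (Real.toNNReal (c / N)) ha.le
  rw [← hexp] at htail
  have hnonneg : 0 ≤ (gaussianReal 0 (Real.toNNReal (c / N))).real {x : ℝ | |x| < a} :=
    measureReal_nonneg
  rw [measureReal_def] at htail hnonneg
  refine le_trans ?_ (one_add_mul_sub_le_pow (by linarith) N)
  gcongr
  linarith
end

section
/- Fix N ≥ 1 and real numbers a_j, b_j, d_j for j = 0, …, N−1, and let H (of size 2N+1) and T (of size 2N+2) be the matrices defined as follows: H = fromBlocks A B Bᵀ D with A = diag(0, −a₀, …, −a_{N−1}), D = diag(−d₀, …, −d_{N−1}), and B the (N+1)×N matrix with B[j,j] = −1, B[j+1,j] = 1 − b_j; T has only nonzero entries T[0,1] = −1 and, for j = 0, …, N−1: T[2j+1, 2j] = −1, T[2j+1, 2j+1] = −d_j, T[2j+1, 2j+2] = 1 − b_j, T[2j+2, 2j+1] = 1 − b_j, T[2j+2, 2j+2] = −a_j, T[2j+2, 2j+3] = −1. Then the characteristic polynomial of T equals X times the characteristic polynomial of H. In particular, the eigenvalues of T are those of H together with one additional zero eigenvalue. -/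
open Matrix Polynomial

/-- The `(N+1) × N` block `B` of the Hessian: `B[j,j] = -1`, `B[j+1,j] = 1 - b j`. -/
def hessB (N : ℕ) (b : Fin N → ℝ) : Matrix (Fin (N + 1)) (Fin N) ℝ :=
  Matrix.of fun i j =>
    if (i : ℕ) = (j : ℕ) then -1
    else if (i : ℕ) = (j : ℕ) + 1 then 1 - b j
    else 0

/-- The `(2N+1) × (2N+1)` Hessian matrix `H = fromBlocks A B Bᵀ D` with
`A = diag(0, -a₀, …, -a_{N-1})` and `D = diag(-d₀, …, -d_{N-1})`. -/
def hessH (N : ℕ) (a b d : Fin N → ℝ) :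
    Matrix (Fin (N + 1) ⊕ Fin N) (Fin (N + 1) ⊕ Fin N) ℝ :=
  fromBlocks (Matrix.diagonal (Fin.cons 0 fun j => -a j)) (hessB N b)
    (hessB N b)ᵀ (Matrix.diagonal fun j => -d j)

/-- The `(2N+2) × (2N+2)` tridiagonal matrix `T` whose only nonzero entries are
`T[0,1] = -1` and, for `j = 0, …, N-1`: `T[2j+1, 2j] = -1`, `T[2j+1, 2j+1] = -dⱼ`,
`T[2j+1, 2j+2] = 1 - bⱼ`, `T[2j+2, 2j+1] = 1 - bⱼ`, `T[2j+2, 2j+2] = -aⱼ`,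
`T[2j+2, 2j+3] = -1`. -/
def triT (N : ℕ) (a b d : Fin N → ℝ) :
    Matrix (Fin (2 * N + 2)) (Fin (2 * N + 2)) ℝ :=
  Matrix.of fun i j =>
    if (i : ℕ) = 0 then (if (j : ℕ) = 1 then -1 else 0)
    else if (i : ℕ) % 2 = 1 then
      if h : (i : ℕ) / 2 < N then
        if (j : ℕ) = (i : ℕ) - 1 then -1
        else if (j : ℕ) = (i : ℕ) then -d ⟨(i : ℕ) / 2, h⟩
        else if (j : ℕ) = (i : ℕ) + 1 then 1 - b ⟨(i : ℕ) / 2, h⟩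
        else 0
      else 0
    else
      if h : (i : ℕ) / 2 - 1 < N then
        if (j : ℕ) = (i : ℕ) - 1 then 1 - b ⟨(i : ℕ) / 2 - 1, h⟩
        else if (j : ℕ) = (i : ℕ) then -a ⟨(i : ℕ) / 2 - 1, h⟩
        else if (j : ℕ) = (i : ℕ) + 1 then -1
        else 0
      else 0

/-- The order in which the two blocks of `hessH` and one extra index (placed last) are interleaved
in `triT`: the upper block occupies the even positions, the lower block the odd ones. -/
noncomputable def interleaveEquiv (N : ℕ) :
    (Fin (N + 1) ⊕ Fin N) ⊕ Unit ≃ Fin (2 * N + 2) :=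
  Equiv.ofBijective
    (Sum.elim
      (Sum.elim (fun i => ⟨2 * i, by lia⟩) (fun j => ⟨2 * j + 1, by lia⟩))
      (fun _ => ⟨2 * N + 1, by lia⟩)) <| by
    refine (Fintype.bijective_iff_injective_and_card _).2 ⟨?_, ?_⟩
    · rintro ((i | i) | i) ((j | j) | j) h <;> simp [Fin.ext_iff] at h ⊢ <;> lia
    · simp; lia

section

variable {N : ℕ}

@[simp]
lemma interleaveEquiv_inl_inl (i : Fin (N + 1)) :
    (interleaveEquiv N (.inl (.inl i)) : ℕ) = 2 * i := rfl

@[simp]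
lemma interleaveEquiv_inl_inr (j : Fin N) :
    (interleaveEquiv N (.inl (.inr j)) : ℕ) = 2 * j + 1 := rfl

@[simp]
lemma interleaveEquiv_inr (u : Unit) :
    (interleaveEquiv N (.inr u) : ℕ) = 2 * N + 1 := rfl

lemma triT_interleaveEquiv_inr (a b d : Fin N → ℝ) (u : Unit) (j : Fin (2 * N + 2)) :
    triT N a b d (interleaveEquiv N (.inr u)) j = 0 := by
  have h : ¬ (2 * N + 1) / 2 < N := by lia
  have h' : (2 * N + 1) % 2 = 1 := by lia
  simp [-Fin.val_eq_zero_iff, triT, h, h']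

lemma triT_interleaveEquiv_inl (a b d : Fin N → ℝ) (i j : Fin (N + 1) ⊕ Fin N) :
    triT N a b d (interleaveEquiv N (.inl i)) (interleaveEquiv N (.inl j)) =
      hessH N a b d i j := by
  rcases i with i | i
  · induction i using Fin.cases with
    | zero =>
      rcases j with j | j
      · induction j using Fin.cases <;> simp [-Fin.val_eq_zero_iff, triT, hessH, Fin.ext_iff]
      · simp [-Fin.val_eq_zero_iff, triT, hessH, hessB]
        grind
    | succ i =>
      rcases j with j | j
      · induction j using Fin.cases with
        | zero => simp [-Fin.val_eq_zero_iff, triT, hessH]; grind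
        | succ j => simp [-Fin.val_eq_zero_iff, triT, hessH, diagonal_apply, Fin.ext_iff]; grind
      · simp [-Fin.val_eq_zero_iff, triT, hessH, hessB]
        grind
  · have hi : (2 * (i : ℕ) + 1) / 2 = i := by lia
    have hm : (2 * (i : ℕ) + 1) % 2 = 1 := by lia
    rcases j with j | j
    · simp [-Fin.val_eq_zero_iff, triT, hessH, hessB, hi, hm]
      grind
    · simp [-Fin.val_eq_zero_iff, triT, hessH, diagonal_apply, hi, hm, Fin.ext_iff]
      grind

lemma triT_submatrix_interleaveEquiv (a b d : Fin N → ℝ) :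
    (triT N a b d).submatrix (interleaveEquiv N) (interleaveEquiv N) =
      fromBlocks (hessH N a b d)
        ((triT N a b d).submatrix (interleaveEquiv N) (interleaveEquiv N)).toBlocks₁₂ 0 0 := by
  ext (i | i) (j | j)
  · exact triT_interleaveEquiv_inl a b d i j
  · rfl
  · exact triT_interleaveEquiv_inr a b d i _
  · exact triT_interleaveEquiv_inr a b d i _

end

/-- the characteristic polynomial of `T` is `X` times the characteristic
polynomial of `H`; in particular the eigenvalues of `T` are those of `H` together with
one additional zero eigenvalue. -/
theorem charpoly_interleaved (N : ℕ) (hN : 1 ≤ N) (a b d : Fin N → ℝ) :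
    (triT N a b d).charpoly = X * (hessH N a b d).charpoly := by
  rw [← charpoly_reindex (interleaveEquiv N).symm, reindex_apply, Equiv.symm_symm,
    triT_submatrix_interleaveEquiv, charpoly_fromBlocks_zero₂₁, charpoly_zero]
  simp [mul_comm]
end

section
/- Let L, X, Y, Z and x_i, x_{i+1}, y_i, y_{i+1} be real numbers with x_i ≠ 0 and x_{i+1} ≠ 0, satisfying the two equations L·x_{i+1} = −y_i − y_{i+1} + (Z/2)·x_{i+1} and L·y_i = −x_i − (Y/2)·y_i − exp(−2X)·x_{i+1}. Set r = y_i / x_i and r′ = y_{i+1} / x_{i+1}. Then (2L + Y)·r + 2 ≠ 0 and r′ = ( (2·exp(−2X) − (1/2)·(2L + Y)·(2L − Z))·r − (2L − Z) ) / ( (2L + Y)·r + 2 ). -/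
open Real

/-- the eigenvalue equations of the tridiagonal matrix imply that the
ratios `r = yᵢ/xᵢ` evolve by the explicit Möbius transformation. -/
theorem ratio_evolution (L X Y Z xi xi1 yi yi1 : ℝ)
    (hxi : xi ≠ 0) (hxi1 : xi1 ≠ 0)
    (h1 : L * xi1 = -yi - yi1 + (Z / 2) * xi1)
    (h2 : L * yi = -xi - (Y / 2) * yi - exp (-2 * X) * xi1) :
    (2 * L + Y) * (yi / xi) + 2 ≠ 0 ∧
      yi1 / xi1 =
        ((2 * exp (-2 * X) - (1 / 2) * (2 * L + Y) * (2 * L - Z)) * (yi / xi) - (2 * L - Z)) /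
          ((2 * L + Y) * (yi / xi) + 2) := by
  have hE : exp (-2 * X) ≠ 0 := (exp_pos _).ne'
  have hD : (2 * L + Y) * (yi / xi) + 2 = -2 * exp (-2 * X) * xi1 / xi := by
    rw [eq_div_iff hxi, add_mul, mul_assoc, div_mul_cancel₀ _ hxi]
    linear_combination 2 * h2
  have hD0 : (2 * L + Y) * (yi / xi) + 2 ≠ 0 := by
    rw [hD]
    exact div_ne_zero (mul_ne_zero (mul_ne_zero (by norm_num) hE) hxi1) hxi
  refine ⟨hD0, ?_⟩
  have hN : (2 * exp (-2 * X) - (1 / 2) * (2 * L + Y) * (2 * L - Z)) * (yi / xi) - (2 * L - Z) =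
      2 * exp (-2 * X) * (yi / xi) - (1 / 2) * (2 * L - Z) * ((2 * L + Y) * (yi / xi) + 2) := by
    ring
  rw [eq_div_iff hD0, hN, hD]
  generalize exp (-2 * X) = E
  field_simp
  linear_combination (-2 * E) * h1
end

section
/- Fix t ∈ (−π, π). For v > 0 let μ_v be the Gaussian measure on ℝ with mean 0 and variance v, and define G_t : ℝ³ → ℝ by G_t(x, y, z) = 2·arctan( ( tan(t/2)·(2·exp(−2x) + y·z/2) + z ) / ( 2 + y·tan(t/2) ) ). Then the limit, as v → 0⁺, of (1/v)·∫ (G_t(x,y,z) − t) d(μ_v ⊗ μ_v ⊗ μ_v)(x,y,z) equals (7/8)·sin(2t). -/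
open MeasureTheory ProbabilityTheory Filter Real Set Asymptotics
open scoped NNReal Topology

/-- If `R = o(‖x‖²)` at the origin and `R` grows at most quadratically, then the expectation of `R`
under the rescaling of `μ` by `√v` is `o(v)`. -/
theorem tendsto_inv_mul_integral_sqrt_smul_of_isLittleO {E : Type*} [NormedAddCommGroup E]
    [NormedSpace ℝ E] [MeasurableSpace E] [BorelSpace E] {μ : Measure E}
    (hμ : Integrable (fun x => ‖x‖ ^ 2) μ) {R : E → ℝ} (hR : Measurable R)
    (ho : R =o[𝓝 0] fun x => ‖x‖ ^ 2) {C : ℝ} (hC : ∀ x, |R x| ≤ C * (1 + ‖x‖ ^ 2)) :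
    Tendsto (fun v : ℝ => 1 / v * ∫ x, R (√v • x) ∂μ) (𝓝[>] 0) (𝓝 0) := by
  obtain ⟨δ, hδ, hball⟩ := Metric.eventually_nhds_iff.1 (ho.def one_pos)
  have hC0 : 0 ≤ C := by simpa using (abs_nonneg _).trans (hC 0)
  have hbound : ∀ x, |R x| ≤ (1 + C * (1 / δ ^ 2 + 1)) * ‖x‖ ^ 2 := by
    intro x
    rcases lt_or_ge ‖x‖ δ with hx | hx
    · have h := hball (y := x) (by simpa using hx)
      simp only [norm_eq_abs, one_mul, abs_pow, abs_norm] at h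
      have : 0 ≤ C * (1 / δ ^ 2 + 1) * ‖x‖ ^ 2 := by positivity
      linarith
    · have h1 : 1 ≤ 1 / δ ^ 2 * ‖x‖ ^ 2 := by
        rw [one_div_mul_eq_div, one_le_div (by positivity)]
        gcongr
      have h2 : C * (1 + ‖x‖ ^ 2) ≤ C * (1 / δ ^ 2 * ‖x‖ ^ 2 + ‖x‖ ^ 2) := by gcongr
      linarith [hC x, sq_nonneg ‖x‖]
  simp_rw [← integral_const_mul]
  suffices h : Tendsto (fun v : ℝ => ∫ x, 1 / v * R (√v • x) ∂μ) (𝓝[>] 0) (𝓝 (∫ _, 0 ∂μ)) by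
    simpa using h
  refine tendsto_integral_filter_of_dominated_convergence
    (fun x => (1 + C * (1 / δ ^ 2 + 1)) * ‖x‖ ^ 2) ?_ ?_ (hμ.const_mul _) ?_
  · exact .of_forall fun v => ((hR.comp (measurable_const_smul (√v))).const_mul _).aestronglyMeasurable
  · filter_upwards [self_mem_nhdsWithin] with v (hv : 0 < v)
    refine .of_forall fun x => ?_
    have h := hbound (√v • x)
    rw [norm_smul, mul_pow, norm_eq_abs, sq_abs, sq_sqrt hv.le] at h
    rw [norm_mul, norm_eq_abs, norm_eq_abs, abs_of_pos (one_div_pos.2 hv), one_div_mul_eq_div,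
      div_le_iff₀ hv]
    linarith
  · refine .of_forall fun x => ?_
    have hlim : Tendsto (fun v : ℝ => √v • x) (𝓝[>] 0) (𝓝 0) := by
      have : Continuous fun v : ℝ => √v • x := by fun_prop
      simpa using (this.tendsto 0).mono_left nhdsWithin_le_nhds
    have hO : (fun v : ℝ => ‖√v • x‖ ^ 2) =O[𝓝[>] 0] fun v : ℝ => v := by
      refine IsBigO.of_bound (‖x‖ ^ 2) ?_
      filter_upwards [self_mem_nhdsWithin] with v (hv : 0 < v)
      simp [norm_smul, mul_pow, sq_sqrt hv.le, mul_comm]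
    refine ((ho.comp_tendsto hlim).trans_isBigO hO).tendsto_div_nhds_zero.congr fun v => ?_
    simp [div_eq_inv_mul]

/-- The second order Taylor formula with Peano remainder. -/
theorem isLittleO_sub_taylor_two {f f' : ℝ → ℝ} {f'' x₀ : ℝ} (hf : ∀ x, HasDerivAt f (f' x) x)
    (hf' : HasDerivAt f' f'' x₀) :
    (fun x => f x - (f x₀ + f' x₀ * (x - x₀) + f'' / 2 * (x - x₀) ^ 2)) =o[𝓝 x₀]
      fun x => (x - x₀) ^ 2 := by
  have key := convex_univ.isLittleO_pow_succ_real (mem_univ x₀) (n := 1)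
    (f := fun x => f x - (f x₀ + f' x₀ * (x - x₀) + f'' / 2 * (x - x₀) ^ 2))
    (f' := fun x => f' x - f' x₀ - (x - x₀) * f'') (fun x _ => ?_) ?_
  · simpa using key
  · refine HasDerivAt.hasDerivWithinAt ?_
    have h1 := (hasDerivAt_id x).sub_const x₀
    refine ((hf x).sub (((h1.const_mul (f' x₀)).const_add (f x₀)).add
      ((h1.pow 2).const_mul (f'' / 2)))).congr_deriv ?_
    simp
    ring
  · simpa using hasDerivAt_iff_isLittleO.1 hf'

theorem isLittleO_arctan_sub_taylor_two (a : ℝ) :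
    (fun u => arctan u - (arctan a + (u - a) / (1 + a ^ 2) - a * (u - a) ^ 2 / (1 + a ^ 2) ^ 2))
      =o[𝓝 a] fun u => (u - a) ^ 2 := by
  have h0 : 1 + a ^ 2 ≠ 0 := by positivity
  have hf' : HasDerivAt (fun u : ℝ => (1 + u ^ 2)⁻¹) (-(2 * a) / (1 + a ^ 2) ^ 2) a := by
    have h := ((hasDerivAt_pow 2 a).const_add 1).inv h0
    simp only [Nat.cast_ofNat, Nat.add_one_sub_one, pow_one] at h
    exact h
  refine (isLittleO_sub_taylor_two hasDerivAt_arctan' hf').congr_left fun u => ?_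
  ring

theorem isLittleO_exp_sub_taylor_two :
    (fun u => exp u - (1 + u + u ^ 2 / 2)) =o[𝓝 0] fun u : ℝ => u ^ 2 := by
  have h := isLittleO_sub_taylor_two Real.hasDerivAt_exp (Real.hasDerivAt_exp 0)
  simp only [sub_zero, exp_zero] at h
  exact h.congr_left fun u => by ring

theorem integral_sq_gaussianReal_zero (v : ℝ≥0) : ∫ x, x ^ 2 ∂gaussianReal 0 v = v := by
  have h := variance_fun_id_gaussianReal (μ := 0) (v := v)
  rw [variance_eq_integral measurable_id'.aemeasurable] at h
  simpa using h

theorem integrable_id_gaussianReal (v : ℝ≥0) : Integrable (fun x => x) (gaussianReal 0 v) :=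
  (memLp_id_gaussianReal' 1 (by simp)).integrable le_rfl

theorem integrable_sq_gaussianReal (v : ℝ≥0) : Integrable (fun x => x ^ 2) (gaussianReal 0 v) :=
  (memLp_id_gaussianReal' 2 (by simp)).integrable_sq

/-- The law of three independent centred Gaussian variables of variance `v`. -/
noncomputable abbrev gaussianTriple (v : ℝ≥0) : Measure (ℝ × ℝ × ℝ) :=
  (gaussianReal 0 v).prod ((gaussianReal 0 v).prod (gaussianReal 0 v))

theorem gaussianTriple_eq_map (v : ℝ) (hv : 0 ≤ v) :
    gaussianTriple v.toNNReal = (gaussianTriple 1).map (√v • ·) := by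
  have h : gaussianReal 0 v.toNNReal = (gaussianReal 0 1).map (√v * ·) := by
    rw [gaussianReal_map_const_mul]
    congr 1
    · simp
    · ext
      simp [hv]
  have hm : Measurable fun x : ℝ => √v * x := by fun_prop
  rw [gaussianTriple, h, Measure.map_prod_map _ _ hm hm,
    Measure.map_prod_map _ _ hm (hm.prodMap hm)]
  rfl

/-- A quadratic polynomial without constant term in three variables. -/
def quadPoly (b₁ b₂ b₃ c₁ c₂ c₃ d₁ d₂ d₃ : ℝ) (p : ℝ × ℝ × ℝ) : ℝ :=
  b₁ * p.1 + b₂ * p.2.1 + b₃ * p.2.2 + c₁ * p.1 ^ 2 + c₂ * p.2.1 ^ 2 + c₃ * p.2.2 ^ 2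
    + d₁ * (p.1 * p.2.1) + d₂ * (p.1 * p.2.2) + d₃ * (p.2.1 * p.2.2)

theorem integrable_and_integral_quadPoly (v : ℝ≥0) (b₁ b₂ b₃ c₁ c₂ c₃ d₁ d₂ d₃ : ℝ) :
    Integrable (quadPoly b₁ b₂ b₃ c₁ c₂ c₃ d₁ d₂ d₃) (gaussianTriple v) ∧
      ∫ p, quadPoly b₁ b₂ b₃ c₁ c₂ c₃ d₁ d₂ d₃ p ∂gaussianTriple v = (c₁ + c₂ + c₃) * v := by
  set γ := gaussianReal 0 v
  have i1 : Integrable (fun x => x) γ := integrable_id_gaussianReal v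
  have i2 : Integrable (fun x => x ^ 2) γ := integrable_sq_gaussianReal v
  have m1 : ∫ x, x ∂γ = 0 := integral_id_gaussianReal
  have m2 : ∫ x, x ^ 2 ∂γ = v := integral_sq_gaussianReal_zero v
  have hx := (i1.comp_fst (γ.prod γ)).const_mul b₁
  have hy := ((i1.comp_fst γ).comp_snd γ).const_mul b₂
  have hz := ((i1.comp_snd γ).comp_snd γ).const_mul b₃
  have hxx := (i2.comp_fst (γ.prod γ)).const_mul c₁
  have hyy := ((i2.comp_fst γ).comp_snd γ).const_mul c₂
  have hzz := ((i2.comp_snd γ).comp_snd γ).const_mul c₃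
  have hxy := (i1.mul_prod (i1.comp_fst γ)).const_mul d₁
  have hxz := (i1.mul_prod (i1.comp_snd γ)).const_mul d₂
  have hyz := ((i1.mul_prod i1).comp_snd γ).const_mul d₃
  have s2 := hx.add hy
  have s3 := s2.add hz
  have s4 := s3.add hxx
  have s5 := s4.add hyy
  have s6 := s5.add hzz
  have s7 := s6.add hxy
  have s8 := s7.add hxz
  refine ⟨s8.add hyz, ?_⟩
  refine (integral_add s8 hyz).trans ?_
  rw [integral_add' s7 hxz, integral_add' s6 hxy, integral_add' s5 hzz, integral_add' s4 hyy,
    integral_add' s3 hxx, integral_add' s2 hz, integral_add' hx hy]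
  simp only [integral_const_mul]
  rw [integral_fun_fst (fun x : ℝ => x), integral_fun_snd (fun q : ℝ × ℝ => q.1),
    integral_fun_snd (fun q : ℝ × ℝ => q.2), integral_fun_fst (fun x : ℝ => x ^ 2),
    integral_fun_snd (fun q : ℝ × ℝ => q.1 ^ 2), integral_fun_snd (fun q : ℝ × ℝ => q.2 ^ 2),
    integral_prod_mul (fun x : ℝ => x) (fun q : ℝ × ℝ => q.1),
    integral_prod_mul (fun x : ℝ => x) (fun q : ℝ × ℝ => q.2),
    integral_fun_snd (fun q : ℝ × ℝ => q.1 * q.2),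
    integral_prod_mul (fun x : ℝ => x) (fun x : ℝ => x),
    integral_fun_fst (fun x : ℝ => x), integral_fun_snd (fun x : ℝ => x),
    integral_fun_fst (fun x : ℝ => x ^ 2), integral_fun_snd (fun x : ℝ => x ^ 2)]
  simp only [m1, m2, probReal_univ, smul_eq_mul]
  ring

theorem integrable_norm_sq_gaussianTriple (v : ℝ≥0) :
    Integrable (fun p => ‖p‖ ^ 2) (gaussianTriple v) := by
  refine (integrable_and_integral_quadPoly v 0 0 0 1 1 1 0 0 0).1.mono'
    (by fun_prop) (.of_forall fun p => ?_)
  rw [norm_eq_abs, abs_of_nonneg (by positivity), quadPoly, Prod.norm_def, Prod.norm_def]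
  rcases max_choice ‖p.1‖ (max ‖p.2.1‖ ‖p.2.2‖) with h | h <;>
  rcases max_choice ‖p.2.1‖ ‖p.2.2‖ with h' | h' <;>
  rw [h] <;> try rw [h']
  all_goals
    rw [norm_eq_abs, sq_abs]
    nlinarith [sq_nonneg p.1, sq_nonneg p.2.1, sq_nonneg p.2.2]

theorem isBigO_fst : (fun p : ℝ × ℝ × ℝ => p.1) =O[𝓝 0] fun p => ‖p‖ :=
  .of_bound 1 (.of_forall fun p => by simpa using norm_fst_le p)

theorem isBigO_snd_fst : (fun p : ℝ × ℝ × ℝ => p.2.1) =O[𝓝 0] fun p => ‖p‖ :=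
  .of_bound 1 (.of_forall fun p => by simpa using (norm_fst_le p.2).trans (norm_snd_le p))

theorem isBigO_snd_snd : (fun p : ℝ × ℝ × ℝ => p.2.2) =O[𝓝 0] fun p => ‖p‖ :=
  .of_bound 1 (.of_forall fun p => by simpa using (norm_snd_le p.2).trans (norm_snd_le p))

theorem abs_quadPoly_le (b₁ b₂ b₃ c₁ c₂ c₃ d₁ d₂ d₃ : ℝ) :
    ∃ C, ∀ p, |quadPoly b₁ b₂ b₃ c₁ c₂ c₃ d₁ d₂ d₃ p| ≤ C * (1 + ‖p‖ ^ 2) := by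
  refine ⟨|b₁| + |b₂| + |b₃| + |c₁| + |c₂| + |c₃| + |d₁| + |d₂| + |d₃|,
    fun p => ?_⟩
  have hx : |p.1| ≤ ‖p‖ := norm_fst_le p
  have hy : |p.2.1| ≤ ‖p‖ := (norm_fst_le p.2).trans (norm_snd_le p)
  have hz : |p.2.2| ≤ ‖p‖ := (norm_snd_le p.2).trans (norm_snd_le p)
  have h1 : ‖p‖ ≤ 1 + ‖p‖ ^ 2 := by nlinarith [sq_nonneg (‖p‖ - 1)]
  have lin : ∀ (b : ℝ) {x : ℝ}, |x| ≤ ‖p‖ → |b * x| ≤ |b| * (1 + ‖p‖ ^ 2) := fun b x h => by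
    rw [abs_mul]
    exact mul_le_mul_of_nonneg_left (h.trans h1) (abs_nonneg b)
  have quad : ∀ (b : ℝ) {x y : ℝ}, |x| ≤ ‖p‖ → |y| ≤ ‖p‖ →
      |b * (x * y)| ≤ |b| * (1 + ‖p‖ ^ 2) := fun b x y h h' => by
    rw [abs_mul, abs_mul]
    refine mul_le_mul_of_nonneg_left ?_ (abs_nonneg b)
    nlinarith [mul_le_mul h h' (abs_nonneg y) (norm_nonneg p)]
  simp only [quadPoly, pow_two p.1, pow_two p.2.1, pow_two p.2.2]
  simp only [add_mul _ _ (1 + ‖p‖ ^ 2)]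
  refine (abs_add_le _ _).trans (add_le_add ?_ (quad d₃ hy hz))
  refine (abs_add_le _ _).trans (add_le_add ?_ (quad d₂ hx hz))
  refine (abs_add_le _ _).trans (add_le_add ?_ (quad d₁ hx hy))
  refine (abs_add_le _ _).trans (add_le_add ?_ (quad c₃ hz hz))
  refine (abs_add_le _ _).trans (add_le_add ?_ (quad c₂ hy hy))
  refine (abs_add_le _ _).trans (add_le_add ?_ (quad c₁ hx hx))
  refine (abs_add_le _ _).trans (add_le_add ?_ (lin b₃ hz))
  exact (abs_add_le _ _).trans (add_le_add (lin b₁ hx) (lin b₂ hy))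

theorem measurable_quadPoly (b₁ b₂ b₃ c₁ c₂ c₃ d₁ d₂ d₃ : ℝ) :
    Measurable (quadPoly b₁ b₂ b₃ c₁ c₂ c₃ d₁ d₂ d₃) := by
  unfold quadPoly
  fun_prop

/-- If a bounded function agrees near the origin with a quadratic polynomial up to `o(‖p‖²)`, then
its Gaussian expectation divided by the variance tends to the trace of the quadratic part. -/
theorem tendsto_inv_mul_integral_gaussianTriple {g : ℝ × ℝ × ℝ → ℝ} (hg : Measurable g)
    {C : ℝ} (hC : ∀ p, |g p| ≤ C) {b₁ b₂ b₃ c₁ c₂ c₃ d₁ d₂ d₃ : ℝ}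
    (ho : (fun p => g p - quadPoly b₁ b₂ b₃ c₁ c₂ c₃ d₁ d₂ d₃ p) =o[𝓝 0] fun p => ‖p‖ ^ 2) :
    Tendsto (fun v : ℝ => 1 / v * ∫ p, g p ∂gaussianTriple v.toNNReal) (𝓝[>] 0)
      (𝓝 (c₁ + c₂ + c₃)) := by
  set P := quadPoly b₁ b₂ b₃ c₁ c₂ c₃ d₁ d₂ d₃
  have hPm : Measurable P := measurable_quadPoly ..
  obtain ⟨K, hK⟩ := abs_quadPoly_le b₁ b₂ b₃ c₁ c₂ c₃ d₁ d₂ d₃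
  have hR := tendsto_inv_mul_integral_sqrt_smul_of_isLittleO
    (integrable_norm_sq_gaussianTriple 1) (hg.sub hPm) ho (C := C + K) fun p => by
      have h1 := abs_sub (g p) (P p)
      have h2 := hC p
      have h3 := hK p
      have h4 : 0 ≤ C * ‖p‖ ^ 2 := mul_nonneg ((abs_nonneg _).trans h2) (sq_nonneg _)
      simp only [Pi.sub_apply]
      linarith
  rw [← zero_add (c₁ + c₂ + c₃)]
  refine (hR.add_const (c₁ + c₂ + c₃)).congr' ?_
  filter_upwards [self_mem_nhdsWithin] with v (hv : 0 < v)
  obtain ⟨hPi, hPint⟩ := integrable_and_integral_quadPoly v.toNNReal b₁ b₂ b₃ c₁ c₂ c₃ d₁ d₂ d₃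
  have hgi : Integrable g (gaussianTriple v.toNNReal) :=
    .of_bound hg.aestronglyMeasurable C (.of_forall hC)
  have hmap : ∫ p, (g - P) (√v • p) ∂gaussianTriple 1 =
      ∫ p, (g - P) p ∂gaussianTriple v.toNNReal := by
    rw [gaussianTriple_eq_map v hv.le,
      integral_map (measurable_const_smul _).aemeasurable (hg.sub hPm).aestronglyMeasurable]
  rw [hmap, integral_sub' hgi hPi, hPint, coe_toNNReal v hv.le]
  field_simp
  ring

/-- The second order expansion at the origin of the random Möbius map applied to `a`. -/
theorem isLittleO_moebius_sub (a : ℝ) :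
    (fun p : ℝ × ℝ × ℝ => (a * (2 * exp (-2 * p.1) + p.2.1 * p.2.2 / 2) + p.2.2) / (2 + p.2.1 * a) -
      (a + quadPoly (-2 * a) (-a ^ 2 / 2) (1 / 2) (2 * a) (a ^ 3 / 4) 0 (a ^ 2) 0 0 p))
      =o[𝓝 0] fun p => ‖p‖ ^ 2 := by
  have hx := isBigO_fst
  have hy := isBigO_snd_fst
  have hone : (fun p : ℝ × ℝ × ℝ => p.2.1) =o[𝓝 0] fun _ => (1 : ℝ) :=
    (isLittleO_one_iff ℝ).2 <| by
      simpa using (by fun_prop : Continuous fun p : ℝ × ℝ × ℝ => p.2.1).tendsto 0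
  have hexp : (fun p : ℝ × ℝ × ℝ => exp (-2 * p.1) - (1 + -2 * p.1 + (-2 * p.1) ^ 2 / 2))
      =o[𝓝 0] fun p => ‖p‖ ^ 2 :=
    (isLittleO_exp_sub_taylor_two.comp_tendsto <| by
      simpa using (by fun_prop : Continuous fun p : ℝ × ℝ × ℝ => -2 * p.1).tendsto 0).trans_isBigO
      ((hx.const_mul_left (-2)).pow 2)
  have hquad : (fun p : ℝ × ℝ × ℝ =>
      2 * a * p.1 ^ 2 + a ^ 3 / 4 * p.2.1 ^ 2 + a ^ 2 * (p.1 * p.2.1)) =O[𝓝 0] fun p => ‖p‖ ^ 2 :=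
    (((hx.pow 2).const_mul_left _).add ((hy.pow 2).const_mul_left _)).add
      (((hx.mul hy).congr_right fun p => (pow_two _).symm).const_mul_left _)
  have hnum := (hexp.const_mul_left (2 * a)).sub
    (((hone.mul_isBigO hquad).congr_right fun p => one_mul _).const_mul_left a)
  have hden : (fun p : ℝ × ℝ × ℝ => (2 + p.2.1 * a)⁻¹) =O[𝓝 0] fun _ => (1 : ℝ) := by
    refine Tendsto.isBigO_one ℝ (c := 2⁻¹) (Tendsto.inv₀ ?_ two_ne_zero)
    simpa using (by fun_prop : Continuous fun p : ℝ × ℝ × ℝ => 2 + p.2.1 * a).tendsto 0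
  have hne : ∀ᶠ p : ℝ × ℝ × ℝ in 𝓝 0, 2 + p.2.1 * a ≠ 0 :=
    (by fun_prop : Continuous fun p : ℝ × ℝ × ℝ => 2 + p.2.1 * a).continuousAt.eventually_ne
      (by simp)
  refine (hnum.mul_isBigO hden).congr' ?_ (.of_forall fun p => mul_one _)
  filter_upwards [hne] with p hp
  rw [quadPoly, ← div_eq_mul_inv, eq_sub_iff_add_eq, div_add' _ _ _ hp]
  congr 1
  ring

/-- The second order expansion at the origin of `arctan` of the random Möbius map. -/
theorem isLittleO_arctan_moebius_sub (a : ℝ) :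
    (fun p : ℝ × ℝ × ℝ =>
      arctan ((a * (2 * exp (-2 * p.1) + p.2.1 * p.2.2 / 2) + p.2.2) / (2 + p.2.1 * a)) - arctan a -
      quadPoly (-2 * a / (1 + a ^ 2)) (-a ^ 2 / 2 / (1 + a ^ 2)) (1 / 2 / (1 + a ^ 2))
        (2 * a / (1 + a ^ 2) - a * (2 * a) ^ 2 / (1 + a ^ 2) ^ 2)
        (a ^ 3 / 4 / (1 + a ^ 2) - a * (a ^ 2 / 2) ^ 2 / (1 + a ^ 2) ^ 2)
        (-a * (1 / 2) ^ 2 / (1 + a ^ 2) ^ 2)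
        (a ^ 2 / (1 + a ^ 2) - a * (2 * a ^ 3) / (1 + a ^ 2) ^ 2)
        (2 * a ^ 2 / (1 + a ^ 2) ^ 2) (a * a ^ 2 / 2 / (1 + a ^ 2) ^ 2) p)
      =o[𝓝 0] fun p => ‖p‖ ^ 2 := by
  have hx := isBigO_fst
  have hy := isBigO_snd_fst
  have hz := isBigO_snd_snd
  set F : ℝ × ℝ × ℝ → ℝ := fun p =>
    (a * (2 * exp (-2 * p.1) + p.2.1 * p.2.2 / 2) + p.2.2) / (2 + p.2.1 * a) with hF
  set l : ℝ × ℝ × ℝ → ℝ := fun p => -2 * a * p.1 + -a ^ 2 / 2 * p.2.1 + 1 / 2 * p.2.2 with hl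
  set q : ℝ × ℝ × ℝ → ℝ := fun p =>
    2 * a * p.1 ^ 2 + a ^ 3 / 4 * p.2.1 ^ 2 + a ^ 2 * (p.1 * p.2.1) with hq
  have hFlq : (fun p => F p - a - l p - q p) =o[𝓝 0] fun p => ‖p‖ ^ 2 :=
    (isLittleO_moebius_sub a).congr_left fun p => by
      simp only [hF, hl, hq, quadPoly]
      ring
  have hlO : l =O[𝓝 0] fun p => ‖p‖ :=
    ((hx.const_mul_left _).add (hy.const_mul_left _)).add (hz.const_mul_left _)
  have hqO : q =O[𝓝 0] fun p => ‖p‖ ^ 2 :=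
    (((hx.pow 2).const_mul_left _).add ((hy.pow 2).const_mul_left _)).add
      (((hx.mul hy).congr_right fun p => (pow_two _).symm).const_mul_left _)
  have hnorm : (fun p : ℝ × ℝ × ℝ => ‖p‖) =o[𝓝 0] fun _ => (1 : ℝ) :=
    (isLittleO_one_iff ℝ).2 tendsto_norm_zero
  have hsq : (fun p : ℝ × ℝ × ℝ => ‖p‖ ^ 2) =o[𝓝 0] fun p => ‖p‖ :=
    (hnorm.mul_isBigO (isBigO_refl (fun p => ‖p‖) _)).congr (fun p => (pow_two _).symm)
      fun p => one_mul _
  have hFl : (fun p => F p - a - l p) =O[𝓝 0] fun p => ‖p‖ ^ 2 :=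
    (hFlq.isBigO.add hqO).congr_left fun p => by ring
  have hFa : (fun p => F p - a) =O[𝓝 0] fun p => ‖p‖ :=
    ((hFl.trans hsq.isBigO).add hlO).congr_left fun p => by ring
  have hFlim : Tendsto F (𝓝 0) (𝓝 a) := by
    rw [tendsto_iff_norm_sub_tendsto_zero]
    simpa using (hFa.trans_tendsto tendsto_norm_zero).norm
  have hsquare : (fun p => (F p - a) ^ 2 - l p ^ 2) =o[𝓝 0] fun p => ‖p‖ ^ 2 :=
    ((hFl.trans_isLittleO hsq).mul_isBigO (hFa.add hlO)).congr (fun p => by ring)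
      fun p => (pow_two _).symm
  have htaylor := ((isLittleO_arctan_sub_taylor_two a).comp_tendsto hFlim).trans_isBigO (hFa.pow 2)
  refine ((htaylor.add (hFlq.const_mul_left (1 + a ^ 2)⁻¹)).sub
    (hsquare.const_mul_left (a / (1 + a ^ 2) ^ 2))).congr_left fun p => ?_
  simp only [Function.comp_apply, quadPoly, hl, hq]
  ring

/-- one-step drift estimate for the random Möbius evolution at angle `t`:
`(1/v) E[G_t - t] → (7/8) sin (2t)` as the variance `v → 0⁺`. -/
theorem one_step_drift (t : ℝ) (ht : t ∈ Ioo (-π) π) :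
    Tendsto
      (fun v : ℝ =>
        (1 / v) *
          ∫ p : ℝ × ℝ × ℝ,
            (2 * arctan
                ((tan (t / 2) * (2 * exp (-2 * p.1) + p.2.1 * p.2.2 / 2) + p.2.2) /
                  (2 + p.2.1 * tan (t / 2))) - t)
            ∂((gaussianReal 0 (Real.toNNReal v)).prod
                ((gaussianReal 0 (Real.toNNReal v)).prod (gaussianReal 0 (Real.toNNReal v)))))
      (nhdsWithin 0 (Ioi 0)) (nhds ((7 / 8) * sin (2 * t))) := by
  have hlt := ht.1
  have hgt := ht.2
  set a := tan (t / 2) with ha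
  have hat : arctan a = t / 2 := arctan_tan (by linarith) (by linarith)
  have hsin : sin (2 * t) = 4 * a * (1 - a ^ 2) / (1 + a ^ 2) ^ 2 := by
    have hc : cos (t / 2) ≠ 0 := (cos_pos_of_mem_Ioo ⟨by linarith, by linarith⟩).ne'
    have hs : sin (t / 2) = a * cos (t / 2) := (tan_mul_cos hc).symm
    have hcc : cos (t / 2) ^ 2 = (1 + a ^ 2)⁻¹ := (inv_one_add_tan_sq hc).symm
    have h2 : 2 * t = 2 * (2 * (t / 2)) := by ring
    rw [h2, sin_two_mul, cos_two_mul', sin_two_mul, hs]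
    have h3 : 2 * (2 * (a * cos (t / 2)) * cos (t / 2)) *
        (cos (t / 2) ^ 2 - (a * cos (t / 2)) ^ 2) =
        4 * a * (1 - a ^ 2) * (cos (t / 2) ^ 2) ^ 2 := by ring
    rw [h3, hcc, inv_pow, div_eq_mul_inv]
  have hexpansion := (isLittleO_arctan_moebius_sub a).const_mul_left 2
  have hmeas : Measurable fun p : ℝ × ℝ × ℝ => 2 * arctan
      ((a * (2 * exp (-2 * p.1) + p.2.1 * p.2.2 / 2) + p.2.2) / (2 + p.2.1 * a)) - t :=
    ((measurable_arctan.comp (by fun_prop)).const_mul 2).sub_const t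
  have hlim := tendsto_inv_mul_integral_gaussianTriple hmeas (C := 2 * π) (fun p => ?_)
    (hexpansion.congr_left fun p => ?_)
    (b₁ := 2 * (-2 * a / (1 + a ^ 2))) (b₂ := 2 * (-a ^ 2 / 2 / (1 + a ^ 2)))
    (b₃ := 2 * (1 / 2 / (1 + a ^ 2)))
    (c₁ := 2 * (2 * a / (1 + a ^ 2) - a * (2 * a) ^ 2 / (1 + a ^ 2) ^ 2))
    (c₂ := 2 * (a ^ 3 / 4 / (1 + a ^ 2) - a * (a ^ 2 / 2) ^ 2 / (1 + a ^ 2) ^ 2))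
    (c₃ := 2 * (-a * (1 / 2) ^ 2 / (1 + a ^ 2) ^ 2))
    (d₁ := 2 * (a ^ 2 / (1 + a ^ 2) - a * (2 * a ^ 3) / (1 + a ^ 2) ^ 2))
    (d₂ := 2 * (2 * a ^ 2 / (1 + a ^ 2) ^ 2))
    (d₃ := 2 * (a * a ^ 2 / 2 / (1 + a ^ 2) ^ 2))
  · convert hlim using 2
    have h0 : 1 + a ^ 2 ≠ 0 := by positivity
    rw [hsin]
    field_simp
    ring
  · have h1 := arctan_lt_pi_div_two
      ((a * (2 * exp (-2 * p.1) + p.2.1 * p.2.2 / 2) + p.2.2) / (2 + p.2.1 * a))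
    have h2 := neg_pi_div_two_lt_arctan
      ((a * (2 * exp (-2 * p.1) + p.2.1 * p.2.2 / 2) + p.2.2) / (2 + p.2.1 * a))
    rw [abs_le]
    constructor <;> linarith
  · simp only [hat, quadPoly]
    ring
end

section
/- Fix t ∈ (−π, π). For v > 0 let μ_v be the Gaussian measure on ℝ with mean 0 and variance v, and define G_t : ℝ³ → ℝ by G_t(x, y, z) = 2·arctan( ( tan(t/2)·(2·exp(−2x) + y·z/2) + z ) / ( 2 + y·tan(t/2) ) ). Then the limit, as v → 0⁺, of (1/v)·∫ (G_t(x,y,z) − t)² d(μ_v ⊗ μ_v ⊗ μ_v)(x,y,z) equals (1/4)·(11 − 7·cos(2t)). -/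
open MeasureTheory ProbabilityTheory Filter Real Set

/-- The centered Gaussian measure of variance `v` on `ℝ × ℝ × ℝ` is the image of the standard one
under the dilation by `√v`. -/
theorem gaussianReal_prod_prod_eq_map_sqrt_smul {v : ℝ} (hv : 0 ≤ v) :
    (gaussianReal 0 (Real.toNNReal v)).prod
        ((gaussianReal 0 (Real.toNNReal v)).prod (gaussianReal 0 (Real.toNNReal v))) =
      ((gaussianReal 0 1).prod ((gaussianReal 0 1).prod (gaussianReal 0 1))).map
        (fun w : ℝ × ℝ × ℝ => √v • w) := by
  have h : gaussianReal 0 (Real.toNNReal v) = (gaussianReal 0 1).map (fun x => √v * x) := by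
    rw [gaussianReal_map_const_mul]
    congr 1
    · simp
    · ext
      simp [hv]
  have hm : Measurable fun x : ℝ => √v * x := by fun_prop
  rw [h, Measure.map_prod_map _ _ hm hm, Measure.map_prod_map _ _ hm (hm.prodMap hm)]
  rfl

/-- A bounded function on a normed space that vanishes at `0` and is differentiable there is
globally bounded by a multiple of the norm. -/
theorem exists_abs_le_mul_norm_of_differentiableAt {E : Type*} [NormedAddCommGroup E]
    [NormedSpace ℝ E] {g : E → ℝ} {B : ℝ} (h0 : g 0 = 0) (hB : ∀ p, |g p| ≤ B)
    (hg : DifferentiableAt ℝ g 0) : ∃ C : ℝ, ∀ p, |g p| ≤ C * ‖p‖ := by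
  obtain ⟨c, hc⟩ := hg.isBigO_sub.bound
  obtain ⟨δ, hδ, hball⟩ := Metric.eventually_nhds_iff.1 hc
  refine ⟨max c (B / δ), fun p => ?_⟩
  by_cases hp : ‖p‖ < δ
  · have h := hball (y := p) (by simpa using hp)
    simp only [h0, sub_zero, Real.norm_eq_abs] at h
    exact h.trans (mul_le_mul_of_nonneg_right (le_max_left _ _) (norm_nonneg p))
  · have hB0 : 0 ≤ B := (abs_nonneg _).trans (hB p)
    calc |g p| ≤ B := hB p
      _ = B / δ * δ := by field_simp
      _ ≤ B / δ * ‖p‖ := by gcongr; exact not_lt.1 hp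
      _ ≤ _ := mul_le_mul_of_nonneg_right (le_max_right _ _) (norm_nonneg p)

/-- Second-order small-scale asymptotics of `∫ g (√v • w) ^ 2` for a bounded function `g`
vanishing at `0`, whose directional derivatives at `0` are given by `ℓ`. -/
theorem tendsto_inv_mul_integral_sq_sqrt_smul {E : Type*} [NormedAddCommGroup E]
    [NormedSpace ℝ E] [MeasurableSpace E] [BorelSpace E] {μ : Measure E}
    (hμ : MemLp (fun w : E => ‖w‖) 2 μ) {g ℓ : E → ℝ} {B : ℝ}
    (hm : Measurable g) (h0 : g 0 = 0) (hB : ∀ p, |g p| ≤ B) (hg : DifferentiableAt ℝ g 0)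
    (hℓ : ∀ w, HasDerivAt (fun s : ℝ => g (s • w)) (ℓ w) 0) :
    Tendsto (fun v : ℝ => (1 / v) * ∫ w, g (√v • w) ^ 2 ∂μ) (nhdsWithin 0 (Ioi 0))
      (nhds (∫ w, ℓ w ^ 2 ∂μ)) := by
  obtain ⟨C, hC⟩ := exists_abs_le_mul_norm_of_differentiableAt h0 hB hg
  simp_rw [← integral_const_mul]
  refine tendsto_integral_filter_of_dominated_convergence (fun w => C ^ 2 * ‖w‖ ^ 2)
    (.of_forall fun v => ?_) ?_ (hμ.integrable_sq.const_mul _) (.of_forall fun w => ?_)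
  · exact (((hm.comp (measurable_const_smul (√v))).pow_const 2).const_mul _).aestronglyMeasurable
  · filter_upwards [self_mem_nhdsWithin] with v (hv : 0 < v)
    refine .of_forall fun w => ?_
    have h := hC (√v • w)
    rw [norm_smul, Real.norm_eq_abs, abs_of_nonneg (Real.sqrt_nonneg v)] at h
    have h2 : g (√v • w) ^ 2 ≤ (C * (√v * ‖w‖)) ^ 2 := by
      rw [← sq_abs (g _)]
      exact pow_le_pow_left₀ (abs_nonneg _) h 2
    rw [Real.norm_eq_abs, abs_of_nonneg (by positivity), one_div, inv_mul_le_iff₀ hv]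
    calc g (√v • w) ^ 2 ≤ (C * (√v * ‖w‖)) ^ 2 := h2
      _ = √v ^ 2 * (C ^ 2 * ‖w‖ ^ 2) := by ring
      _ = v * (C ^ 2 * ‖w‖ ^ 2) := by rw [Real.sq_sqrt hv.le]
  · have hs : Tendsto (fun v : ℝ => √v) (nhdsWithin 0 (Ioi 0)) (nhdsWithin 0 {0}ᶜ) := by
      refine tendsto_nhdsWithin_iff.2 ⟨?_, ?_⟩
      · simpa using (Real.continuous_sqrt.tendsto 0).mono_left nhdsWithin_le_nhds
      · filter_upwards [self_mem_nhdsWithin] with v (hv : 0 < v)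
        exact (Real.sqrt_pos.2 hv).ne'
    refine (((hasDerivAt_iff_tendsto_slope.1 (hℓ w)).comp hs).pow 2).congr' ?_
    filter_upwards [self_mem_nhdsWithin] with v (hv : 0 < v)
    simp only [Function.comp, slope_def_field, zero_smul, h0, sub_zero, div_pow,
      Real.sq_sqrt hv.le]
    ring

/-- Second moment of a linear form under the standard Gaussian measure on `ℝ × ℝ × ℝ`. -/
theorem integral_linear_sq_gaussianReal_prod_prod (a b c : ℝ) :
    ∫ w : ℝ × ℝ × ℝ, (a * w.1 + (b * w.2.1 + c * w.2.2)) ^ 2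
        ∂((gaussianReal 0 1).prod ((gaussianReal 0 1).prod (gaussianReal 0 1))) =
      a ^ 2 + (b ^ 2 + c ^ 2) := by
  have hL (k : ℝ) : MemLp (fun x : ℝ => k * x) 2 (gaussianReal 0 1) :=
    (memLp_id_gaussianReal 2).const_mul k
  have h0 (k : ℝ) : ∫ x : ℝ, k * x ∂(gaussianReal 0 1) = 0 := by
    rw [integral_const_mul, integral_id_gaussianReal, mul_zero]
  have hV (k : ℝ) : Var[fun x : ℝ => k * x; gaussianReal 0 1] = k ^ 2 := by
    rw [variance_const_mul, variance_fun_id_gaussianReal, NNReal.coe_one, mul_one]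
  have hbc : MemLp (fun q : ℝ × ℝ => b * q.1 + c * q.2) 2
      ((gaussianReal 0 1).prod (gaussianReal 0 1)) :=
    ((hL b).comp_fst _).add ((hL c).comp_snd _)
  have hbc0 : ∫ q : ℝ × ℝ, (b * q.1 + c * q.2)
      ∂((gaussianReal 0 1).prod (gaussianReal 0 1)) = 0 := by
    rw [integral_add (((hL b).integrable one_le_two).comp_fst _)
      (((hL c).integrable one_le_two).comp_snd _), integral_fun_fst (fun x => b * x),
      integral_fun_snd (fun x => c * x), h0, h0]
    simp
  have habc0 : ∫ w : ℝ × ℝ × ℝ, (a * w.1 + (b * w.2.1 + c * w.2.2))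
      ∂((gaussianReal 0 1).prod ((gaussianReal 0 1).prod (gaussianReal 0 1))) = 0 := by
    rw [integral_add (((hL a).integrable one_le_two).comp_fst _)
      ((hbc.integrable one_le_two).comp_snd _), integral_fun_fst (fun x => a * x),
      integral_fun_snd (fun q : ℝ × ℝ => b * q.1 + c * q.2), h0, hbc0]
    simp
  rw [← variance_of_integral_eq_zero (by fun_prop) habc0, variance_add_prod (hL a) hbc,
    variance_add_prod (hL b) (hL c), hV, hV, hV]

/-- The norm is square-integrable for the standard Gaussian measure on `ℝ × ℝ × ℝ`. -/
theorem memLp_norm_gaussianReal_prod_prod :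
    MemLp (fun w : ℝ × ℝ × ℝ => ‖w‖) 2
      ((gaussianReal 0 1).prod ((gaussianReal 0 1).prod (gaussianReal 0 1))) := by
  have h : MemLp (fun x : ℝ => x) 2 (gaussianReal 0 1) := memLp_id_gaussianReal 2
  have h' : MemLp (fun q : ℝ × ℝ => ‖q‖) 2 ((gaussianReal 0 1).prod (gaussianReal 0 1)) :=
    (h.comp_fst _).norm.sup (h.comp_snd _).norm
  exact (h.comp_fst _).norm.sup (h'.comp_snd _)

/-- Directional derivatives at the origin of the angle coordinate of the one-step Möbius
evolution, where `T` is the tangent of half the initial angle. -/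
theorem hasDerivAt_two_mul_arctan_moebius (T t : ℝ) (w : ℝ × ℝ × ℝ) :
    HasDerivAt (fun s : ℝ =>
        2 * arctan ((T * (2 * exp (-2 * (s • w).1) + (s • w).2.1 * (s • w).2.2 / 2) +
          (s • w).2.2) / (2 + (s • w).2.1 * T)) - t)
      (-4 * T / (1 + T ^ 2) * w.1 +
        (-T ^ 2 / (1 + T ^ 2) * w.2.1 + 1 / (1 + T ^ 2) * w.2.2)) 0 := by
  obtain ⟨x, y, z⟩ := w
  simp only [Prod.smul_mk, smul_eq_mul]
  have hx : HasDerivAt (fun s : ℝ => -2 * (s * x)) (-2 * x) 0 := by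
    simpa using ((hasDerivAt_id (0 : ℝ)).mul_const x).const_mul (-2)
  have hy : HasDerivAt (fun s : ℝ => s * y) y 0 := by
    simpa using (hasDerivAt_id (0 : ℝ)).mul_const y
  have hz : HasDerivAt (fun s : ℝ => s * z) z 0 := by
    simpa using (hasDerivAt_id (0 : ℝ)).mul_const z
  have hnum := ((((hx.exp.const_mul 2).add ((hy.mul hz).div_const 2)).const_mul T).add hz)
  have hden := (hy.mul_const T).const_add 2
  have h := (((hnum.div hden (by simp)).arctan).const_mul 2).sub_const t
  refine h.congr_deriv ?_
  have hT : 1 + T ^ 2 ≠ 0 := by positivity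
  simp
  field_simp
  ring

theorem sum_sq_eq_cos_two_mul {t : ℝ} (ht : cos (t / 2) ≠ 0) :
    (-4 * tan (t / 2) / (1 + tan (t / 2) ^ 2)) ^ 2 +
        ((-tan (t / 2) ^ 2 / (1 + tan (t / 2) ^ 2)) ^ 2 + (1 / (1 + tan (t / 2) ^ 2)) ^ 2) =
      (1 / 4) * (11 - 7 * cos (2 * t)) := by
  have hc : (1 + tan (t / 2) ^ 2)⁻¹ = cos (t / 2) ^ 2 := inv_one_add_tan_sq ht
  have hs : tan (t / 2) * cos (t / 2) = sin (t / 2) := tan_mul_cos ht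
  have hcos : cos (2 * t) = 2 * (2 * cos (t / 2) ^ 2 - 1) ^ 2 - 1 := by
    rw [cos_two_mul, ← cos_two_mul (t / 2)]
    ring_nf
  have h2 : tan (t / 2) ^ 2 * cos (t / 2) ^ 2 = 1 - cos (t / 2) ^ 2 := by
    rw [← mul_pow, hs, sin_sq]
  simp only [div_eq_mul_inv _ (1 + tan (t / 2) ^ 2), hc]
  rw [hcos]
  linear_combination (16 * cos (t / 2) ^ 2 + tan (t / 2) ^ 2 * cos (t / 2) ^ 2 + 1 -
    cos (t / 2) ^ 2) * h2

/-- one-step quadratic variation estimate for the random Möbius evolution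
at angle `t`: `(1/v) E[(G_t - t)²] → (1/4)(11 - 7 cos (2t))` as the variance `v → 0⁺`. -/
theorem one_step_quadratic_variation (t : ℝ) (ht : t ∈ Ioo (-π) π) :
    Tendsto
      (fun v : ℝ =>
        (1 / v) *
          ∫ p : ℝ × ℝ × ℝ,
            (2 * arctan
                ((tan (t / 2) * (2 * exp (-2 * p.1) + p.2.1 * p.2.2 / 2) + p.2.2) /
                  (2 + p.2.1 * tan (t / 2))) - t) ^ 2
            ∂((gaussianReal 0 (Real.toNNReal v)).prod
                ((gaussianReal 0 (Real.toNNReal v)).prod (gaussianReal 0 (Real.toNNReal v)))))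
      (nhdsWithin 0 (Ioi 0)) (nhds ((1 / 4) * (11 - 7 * cos (2 * t)))) := by
  have hcos : cos (t / 2) ≠ 0 :=
    (cos_pos_of_mem_Ioo ⟨by linarith [ht.1], by linarith [ht.2]⟩).ne'
  have harctan : arctan (tan (t / 2)) = t / 2 :=
    arctan_tan (by linarith [ht.1]) (by linarith [ht.2])
  rw [← sum_sq_eq_cos_two_mul hcos]
  generalize tan (t / 2) = T at *
  rw [← integral_linear_sq_gaussianReal_prod_prod]
  set g : ℝ × ℝ × ℝ → ℝ := fun p =>
    2 * arctan ((T * (2 * exp (-2 * p.1) + p.2.1 * p.2.2 / 2) + p.2.2) / (2 + p.2.1 * T)) - t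
    with hg
  have hm : Measurable g := by fun_prop
  have h0 : g 0 = 0 := by
    simp [hg, harctan]
    ring
  have hB (p) : |g p| ≤ 2 * π := by
    rw [abs_le]
    have h1 := neg_pi_div_two_lt_arctan
      ((T * (2 * exp (-2 * p.1) + p.2.1 * p.2.2 / 2) + p.2.2) / (2 + p.2.1 * T))
    have h2 := arctan_lt_pi_div_two
      ((T * (2 * exp (-2 * p.1) + p.2.1 * p.2.2 / 2) + p.2.2) / (2 + p.2.1 * T))
    constructor <;> simp only [hg] <;> linarith [ht.1, ht.2]
  have hd : DifferentiableAt ℝ g 0 := by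
    have : (2 : ℝ) + (0 : ℝ × ℝ × ℝ).2.1 * T ≠ 0 := by simp
    exact ((DifferentiableAt.arctan (by fun_prop (disch := assumption))).const_mul 2).sub_const t
  refine (tendsto_inv_mul_integral_sq_sqrt_smul memLp_norm_gaussianReal_prod_prod hm h0 hB hd
    (hasDerivAt_two_mul_arctan_moebius T t)).congr' ?_
  filter_upwards [self_mem_nhdsWithin] with v (hv : 0 < v)
  rw [gaussianReal_prod_prod_eq_map_sqrt_smul hv.le,
    integral_map (by fun_prop) (hm.pow_const 2).aestronglyMeasurable]
end
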